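/- arXiv:1102.4036 — 2 statements merged into one kernel-verified Lean document; each statement's English description precedes it below -/
import Mathlib

section
/- Let V be a vector space over a field k and β a nondegenerate bilinear form on V. For the special orthogonal Lie algebra 𝔤 = 𝔬(V) ⊆ End(V), the map ξ ↦ β_ξ, where β_ξ(v,v') = β(Xv,v') − β(v,Xv') for any X ∈ End(V) with ξ(x) = tr(Xx) for all x ∈ 𝔤, is a well-defined linear isomorphism from 𝔤* onto the space of alternating bilinear forms on V (in characteristic 2), independent of the choice of X representing ξ. -/
/-- The submodule of alternating bilinear forms on `V`. -/
def altForms (k V : Type*) [Field k] [AddCommGroup V] [Module k V] :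
    Submodule k (LinearMap.BilinForm k V) where
  carrier := {B | B.IsAlt}
  add_mem' := by
    intro a b ha hb x
    simp only [LinearMap.add_apply]
    rw [ha x, hb x, add_zero]
  zero_mem' := fun x => rfl
  smul_mem' := by
    intro c B hB x
    simp only [LinearMap.smul_apply]
    rw [hB x, smul_zero]

/-- A bilinear form on a finite-dimensional space admits a generalized inverse. -/
theorem aux_decomp {k V : Type*} [Field k] [AddCommGroup V] [Module k V] [FiniteDimensional k V]
    (β : LinearMap.BilinForm k V) :
    ∃ (n : ℕ) (e f : Fin n → V), ∀ v w, β (∑ i, β v (f i) • e i) w = β v w := by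
  have hproj : Module.Projective k (LinearMap.range β) :=
    Module.Projective.of_basis (Module.Basis.ofVectorSpace k (LinearMap.range β))
  obtain ⟨s, hs⟩ := LinearMap.exists_rightInverse_of_surjective β.rangeRestrict
    (LinearMap.range_rangeRestrict β)
  obtain ⟨G, hG⟩ := LinearMap.exists_extend s
  let b := Module.finBasis k V
  refine ⟨_, fun i => G (b.coord i), b, fun v w => ?_⟩
  have h1 : ∑ i, β v (b i) • b.coord i = β v := by
    apply b.ext
    intro j
    simp
  have h2 : ∑ i, β v (b i) • G (b.coord i) = G (β v) := by
    rw [← congrArg G h1, map_sum]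
    simp only [map_smul]
  have h3 : G (β v) = s (β.rangeRestrict v) := by
    rw [← hG]; rfl
  have h4 := LinearMap.congr_fun hs (β.rangeRestrict v)
  have h5 : β (s (β.rangeRestrict v)) = β v := congrArg Subtype.val h4
  rw [h2, h3, h5]

theorem aux_alt {k V : Type*} [Field k] [AddCommGroup V] [Module k V] [FiniteDimensional k V]
    (B : LinearMap.BilinForm k V) (hB : B.IsAlt) :
    ∃ T : LinearMap.BilinForm k V, ∀ v w, T v w - T w v = B v w := by
  let b := Module.finBasis k V
  let T : LinearMap.BilinForm k V :=
    b.constr k fun i => b.constr k fun j => if i < j then B (b i) (b j) else 0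
  refine ⟨T, fun v w => ?_⟩
  have hTb : ∀ i j, T (b i) (b j) = if i < j then B (b i) (b j) else 0 := fun i j => by
    simp only [T, Module.Basis.constr_basis]
  have : T - LinearMap.flip T = B := by
    apply b.ext; intro i; apply b.ext; intro j
    simp only [LinearMap.sub_apply, LinearMap.flip_apply, hTb]
    rcases lt_trichotomy i j with h | h | h
    · simp [h, h.not_gt]
    · subst h; simp [hB (b i)]
    · simp only [h, h.not_gt, if_true, if_false, zero_sub]
      rw [hB.neg_eq]
  rw [← this]; rfl

/-- The rank two element attached to `a, b`. -/
def auxE {k V : Type*} [Field k] [AddCommGroup V] [Module k V]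
    (β : LinearMap.BilinForm k V) (a b : V) : Module.End k V :=
  (β b).smulRight a - (β a).smulRight b

theorem auxE_apply {k V : Type*} [Field k] [AddCommGroup V] [Module k V]
    (β : LinearMap.BilinForm k V) (a b v : V) : auxE β a b v = β b v • a - β a v • b := rfl

theorem auxE_trace {k V : Type*} [Field k] [AddCommGroup V] [Module k V] [FiniteDimensional k V]
    (β : LinearMap.BilinForm k V) (a b : V) (X : Module.End k V) :
    LinearMap.trace k V (X * auxE β a b) = β b (X a) - β a (X b) := by
  have : X * auxE β a b = (β b).smulRight (X a) - (β a).smulRight (X b) := by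
    ext v; simp [auxE_apply]
  rw [this, map_sub, LinearMap.trace_smulRight, LinearMap.trace_smulRight]

/-- Every element of the orthogonal Lie algebra is a sum of the elements `auxE`. -/
theorem aux_span {k V : Type*} [Field k] [AddCommGroup V] [Module k V] [FiniteDimensional k V]
    (β : LinearMap.BilinForm k V) (hs : ∀ v w, β v w = β w v)
    (x : Module.End k V) (h1 : ∀ v, β (x v) v = 0) (h2 : ∀ v, (∀ w, β v w = 0) → x v = 0) :
    ∃ (n : ℕ) (a b : Fin n → V), x = ∑ i, auxE β (a i) (b i) := by
  obtain ⟨n, e, f, hp⟩ := aux_decomp β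
  obtain ⟨T, hT⟩ := aux_alt (β ∘ₗ x) h1
  let p : Module.End k V := ∑ i, (β (f i)).smulRight (e i)
  have pv : ∀ v, p v = ∑ i, β v (f i) • e i := by
    intro v; simp [p, LinearMap.sum_apply, hs v]
  have hp' : ∀ v w, β (p v) w = β v w := fun v w => by rw [pv, hp]
  have hr : ∀ v, (∀ w, β v w = 0) → p v = 0 := fun v hv => by simp [pv, hv]
  have hpp : ∀ v, p (p v) = p v := fun v => by
    rw [pv (p v), pv v]; simp only [hp' , ← pv]
  have hxp : ∀ v, x (p v) = x v := fun v => by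
    rw [← sub_eq_zero, ← map_sub]; exact h2 _ fun w => by simp [hp']
  let Y0 : Module.End k V := ∑ i, ((T.flip (p (e i))) ∘ₗ p).smulRight (f i)
  have Y0v : ∀ v, Y0 v = ∑ i, T (p v) (p (e i)) • f i := by
    intro v; simp [Y0, LinearMap.sum_apply]
  have hY0 : ∀ v w, β (Y0 v) w = T (p v) (p w) := by
    intro v w
    have : p w = p (p w) := (hpp w).symm
    rw [this, pv w, Y0v]
    simp [hs w, mul_comm]
  have hY0p : ∀ v, Y0 (p v) = Y0 v := fun v => by simp [Y0v, hpp]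
  let A : Module.End k V := ∑ i, (β (Y0 (e i))).smulRight (f i)
  have Av : ∀ v, A v = ∑ i, β (Y0 (e i)) v • f i := by
    intro v; simp [A, LinearMap.sum_apply]
  have hA : ∀ v w, β (A v) w = T (p w) (p v) := by
    intro v w
    rw [← hpp w, pv w, Av]
    simp [hs w, mul_comm, hY0]
  have hAp : ∀ v, A (p v) = A v := fun v => by simp [Av, hY0, hpp]
  let d : Module.End k V := x - Y0 + A
  have hd : ∀ v w, β (d v) w = 0 := by
    intro v w
    have := hT (p v) (p w)
    simp only [LinearMap.comp_apply, hxp] at this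
    rw [hs, hp', hs] at this
    simp only [d, LinearMap.add_apply, LinearMap.sub_apply, map_add, map_sub, hY0, hA, ← this]
    ring
  let Y : Module.End k V := Y0 + d
  have hYp : ∀ v, Y (p v) = Y v := fun v => by
    simp [Y, d, hY0p, hAp, hxp]
  refine ⟨n, fun i => Y (e i), f, LinearMap.ext fun v => ?_⟩
  simp only [LinearMap.sum_apply, auxE_apply, Finset.sum_sub_distrib]
  have e1 : ∑ i, β (f i) v • Y (e i) = Y v := by
    rw [← hYp v, pv v]; simp [hs v]
  have e2 : ∑ i, β (Y (e i)) v • f i = A v := by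
    rw [Av]; simp [Y, hd]
  rw [e1, e2]
  simp only [Y, d, LinearMap.add_apply, LinearMap.sub_apply]
  abel

theorem aux_surj {k V : Type*} [Field k] [AddCommGroup V] [Module k V] [FiniteDimensional k V]
    (β : LinearMap.BilinForm k V) (hs : ∀ v w, β v w = β w v)
    (B : LinearMap.BilinForm k V) (hB : B.IsAlt)
    (h0 : ∀ v w, (∀ u, β v u = 0) → (∀ u, β w u = 0) → B v w = 0) :
    ∃ X : Module.End k V, ∀ v w, β (X v) w - β v (X w) = B v w := by
  obtain ⟨n, e, f, hp⟩ := aux_decomp β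
  obtain ⟨T, hT⟩ := aux_alt B hB
  let p : Module.End k V := ∑ i, (β (f i)).smulRight (e i)
  have pv : ∀ v, p v = ∑ i, β v (f i) • e i := by
    intro v; simp [p, LinearMap.sum_apply, hs v]
  have hp' : ∀ v w, β (p v) w = β v w := fun v w => by rw [pv, hp]
  have hpp : ∀ v, p (p v) = p v := fun v => by
    rw [pv (p v), pv v]; simp only [hp' , ← pv]
  let C : LinearMap.BilinForm k V := T.compl₁₂ p p + B.compl₁₂ (LinearMap.id - p) p
  have Cv : ∀ v w, C v w = T (p v) (p w) + B (v - p v) (p w) := fun v w => by simp [C]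
  let X : Module.End k V := ∑ i, (C.flip (e i)).smulRight (f i)
  have hX : ∀ v w, β (X v) w = C v w := by
    intro v w
    have : C v w = C v (p w) := by rw [Cv, Cv, hpp]
    rw [this, pv w]
    simp [X, LinearMap.sum_apply, hs w, mul_comm]
  refine ⟨X, fun v w => ?_⟩
  rw [hs v, hX, hX, Cv, Cv]
  have a1 := hT (p v) (p w)
  have a2 := h0 (v - p v) (w - p w) (fun u => by simp [hp']) (fun u => by simp [hp'])
  have a3 := hB.neg_eq (w - p w) (p v)
  simp only [map_sub, LinearMap.sub_apply] at a1 a2 a3 ⊢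
  linear_combination a1 - a2 + a3


/-- In characteristic 2, the map `ξ ↦ β_ξ`, `β_ξ(v,v') = β(Xv,v') − β(v,Xv')` for any
`X` with `ξ(x) = tr(Xx)` on `𝔤 = 𝔬(V)`, is a well-defined linear isomorphism from
`𝔤*` onto the space of alternating bilinear forms on `V`. -/
theorem stmt_7 {k V : Type*} [Field k] [IsAlgClosed k] [CharP k 2]
    [AddCommGroup V] [Module k V] [FiniteDimensional k V]
    (Q : QuadraticForm k V)
    (hQ : ∀ v, (∀ w, QuadraticMap.polar Q v w = 0) → v ≠ 0 → Q v ≠ 0)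
    (g : Submodule k (Module.End k V))
    (hg : ∀ X : Module.End k V, X ∈ g ↔
      ((∀ v, QuadraticMap.polar Q (X v) v = 0) ∧
       ∀ v, (∀ w, QuadraticMap.polar Q v w = 0) → X v = 0)) :
    ∃ Φ : Module.Dual k g ≃ₗ[k] altForms k V,
      ∀ (ξ : Module.Dual k g) (X : Module.End k V),
        (∀ x : g, ξ x = LinearMap.trace k V (X * (x : Module.End k V))) →
        ∀ v w : V, ((Φ ξ : LinearMap.BilinForm k V) v) w =
          QuadraticMap.polar Q (X v) w - QuadraticMap.polar Q v (X w) := by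
  set β : LinearMap.BilinForm k V := Q.polarBilin with hβ
  have hβv : ∀ v w, QuadraticMap.polar Q v w = β v w := fun v w => rfl
  simp only [hβv] at hQ hg ⊢
  have hs : ∀ v w, β v w = β w v := fun v w => QuadraticMap.polar_comm Q v w
  have hE : ∀ a b, auxE β a b ∈ g := by
    intro a b
    rw [hg]
    refine ⟨fun v => ?_, fun v hv => ?_⟩
    · simp [auxE_apply, mul_comm]
    · simp [auxE_apply, hs _ v, hv]
  let E : V →ₗ[k] V →ₗ[k] g := LinearMap.mk₂ k (fun a b => ⟨auxE β a b, hE a b⟩)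
    (fun a a' b => by ext v; simp [auxE_apply, add_smul]; abel)
    (fun c a b => by ext v; simp [auxE_apply, smul_sub, smul_smul, mul_comm])
    (fun a b b' => by ext v; simp [auxE_apply, add_smul]; abel)
    (fun c a b => by ext v; simp [auxE_apply, smul_sub, smul_smul, mul_comm])
  have hEv : ∀ a b, ((E a b : g) : Module.End k V) = auxE β a b := fun a b => rfl
  have hEa : ∀ a, E a a = 0 := fun a => by ext v; simp [hEv, auxE_apply]
  let F : Module.Dual k g →ₗ[k] altForms k V :=
    { toFun := fun ξ => ⟨E.compr₂ ξ, fun a => by simp [hEa]⟩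
      map_add' := fun ξ η => by ext; rfl
      map_smul' := fun c ξ => by ext; rfl }
  have hF : ∀ ξ a b, ((F ξ : LinearMap.BilinForm k V) a) b = ξ (E a b) := fun ξ a b => rfl
  have key : ∀ (ξ : Module.Dual k g) (X : Module.End k V),
        (∀ x : g, ξ x = LinearMap.trace k V (X * (x : Module.End k V))) →
        ∀ v w : V, ((F ξ : LinearMap.BilinForm k V) v) w = β (X v) w - β v (X w) := by
    intro ξ X h v w
    rw [hF, h, hEv, auxE_trace, hs w]
  have inj : Function.Injective F := by
    rw [injective_iff_map_eq_zero]
    intro ξ hξ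
    ext x
    obtain ⟨h1, h2⟩ := (hg x).1 x.2
    obtain ⟨n, a, b, hab⟩ := aux_span β hs x h1 h2
    have : x = ∑ i, E (a i) (b i) := by
      apply Subtype.ext
      rw [hab]; simp [hEv]
    rw [this, map_sum]
    simp [← hF, hξ]
  have surj : Function.Surjective F := by
    intro B
    obtain ⟨X, hX⟩ := aux_surj β hs B.1 B.2 (by
      intro r r' hr hr'
      by_cases h : r = 0
      · simp [h]
      have hQr := hQ r hr h
      obtain ⟨c, hc⟩ := IsAlgClosed.exists_pow_nat_eq (Q r' / Q r) (n := 2) two_pos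
      have h0 : Q (r' + c • r) = 0 := by
        rw [QuadraticMap.map_add Q, QuadraticMap.map_smul, hβv, hr', smul_eq_mul, ← pow_two, hc,
          div_mul_cancel₀ _ hQr, add_zero, CharTwo.add_self_eq_zero]
      have h1 : r' + c • r = 0 := by
        by_contra h1
        exact hQ _ (fun w => by simp [hr, hr']) h1 h0
      have h2 : r' = -(c • r) := eq_neg_of_add_eq_zero_left h1
      have h3 : B.1 r r = 0 := B.2 r
      rw [h2]; simp [h3])
    let ξ : Module.Dual k g := (LinearMap.trace k V ∘ₗ LinearMap.mulLeft k X) ∘ₗ g.subtype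
    refine ⟨ξ, ?_⟩
    ext v w
    rw [key ξ X (fun x => rfl), hX]
  exact ⟨LinearEquiv.ofBijective F ⟨inj, surj⟩, key⟩
end

section
/- Over the field with q = 2^n elements, the number of sequences (v_0, …, v_{m-1}) of m linearly independent vectors in a (2N+1)-dimensional quadratic space (V, Q) with Q nondegenerate, such that Q vanishes identically on the span of v_0, …, v_{m-1}, equals $(q^{2N}-1)(q^{2N-2}-1)\cdots(q^{2N-2m+2}-1)\,q^{m(m-1)/2}$. -/
open QuadraticMap in
/-- An alternating form on an odd-dimensional space has a nonzero vector in its radical. -/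
theorem exists_radical {K V : Type*} [Field K] [AddCommGroup V] [Module K V] [Finite V]
    [FiniteDimensional K V] (N : ℕ) (hdim : Module.finrank K V = 2 * N + 1)
    (B : LinearMap.BilinForm K V) (hB : B.IsAlt) : ∃ r : V, r ≠ 0 ∧ ∀ w, B r w = 0 := by
  by_contra hcon
  have hcon : ∀ r : V, (∀ w, B r w = 0) → r = 0 := by
    intro r hr
    by_contra h
    exact hcon ⟨r, h, hr⟩
  have hsymm : ∀ x y, B x y = 0 → B y x = 0 := fun x y h => hB.isRefl x y h
  obtain ⟨U, hU⟩ := Set.Finite.exists_maximal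
    (Set.toFinite {U : Submodule K V | ∀ x ∈ U, ∀ y ∈ U, B x y = 0}) ⟨⊥, by
      intro x hx y hy
      rw [Submodule.mem_bot] at hx
      simp [hx]⟩
  have hUi : ∀ x ∈ U, ∀ y ∈ U, B x y = 0 := hU.prop
  have hUo : B.orthogonal U = U := by
    apply le_antisymm
    · intro x hx
      have hx' : ∀ u ∈ U, B u x = 0 := fun u hu => hx u hu
      have hmem : (U ⊔ K ∙ x) ∈ {U : Submodule K V | ∀ x ∈ U, ∀ y ∈ U, B x y = 0} := by
        intro a ha b hb
        obtain ⟨a1, ha1, a2, ha2, rfl⟩ := Submodule.mem_sup.1 ha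
        obtain ⟨b1, hb1, b2, hb2, rfl⟩ := Submodule.mem_sup.1 hb
        obtain ⟨s, rfl⟩ := Submodule.mem_span_singleton.1 ha2
        obtain ⟨t, rfl⟩ := Submodule.mem_span_singleton.1 hb2
        have h1 := hUi a1 ha1 b1 hb1
        have h2 := hx' a1 ha1
        have h3 := hsymm _ _ (hx' b1 hb1)
        have h4 := hB x
        simp [h1, h2, h3, h4]
      exact hU.le_of_ge hmem le_sup_left
        (Submodule.mem_sup_right (Submodule.mem_span_singleton_self x))
    · intro x hx u hu
      exact hUi u hu x hx
  have h := LinearMap.BilinForm.finrank_add_finrank_orthogonal' (B := B) U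
  have hker : LinearMap.ker B = ⊥ := by
    rw [LinearMap.ker_eq_bot']
    intro r hr
    exact hcon r fun w => by rw [hr]; rfl
  rw [hker, inf_bot_eq, finrank_bot, hUo, hdim] at h
  omega

open QuadraticMap in
/-- Number of ways of extending a totally singular subspace by one vector. -/
theorem card_extend {K V : Type*} [Field K] [Fintype K] [AddCommGroup V] [Module K V] [Finite V]
    [FiniteDimensional K V] [CharP K 2] (N j : ℕ) (hdim : Module.finrank K V = 2 * N + 1)
    (hj : j ≤ N) (Q : QuadraticForm K V)
    (hQ : ∀ v, (∀ w, polar Q v w = 0) → v ≠ 0 → Q v ≠ 0)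
    (r : V) (hr0 : r ≠ 0) (hr : ∀ w, polar Q r w = 0)
    (U : Submodule K V) (hU : Module.finrank K U = j) (hUQ : ∀ x ∈ U, Q x = 0) :
    Nat.card {x : V // x ∉ U ∧ Q x = 0 ∧ ∀ u ∈ U, polar Q u x = 0} =
      Fintype.card K ^ j * (Fintype.card K ^ (2 * N - 2 * j) - 1) := by
  classical
  set q := Fintype.card K with hq
  have hqpos : 0 < q := Fintype.card_pos
  let B : LinearMap.BilinForm K V := polarBilin Q
  have hBa : ∀ x y, B x y = polar Q x y := fun x y => rfl
  have hUpol : ∀ x ∈ U, ∀ y ∈ U, polar Q x y = 0 := by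
    intro x hx y hy
    simp [polar, hUQ _ hx, hUQ _ hy, hUQ _ (U.add_mem hx hy)]
  have hrank : Module.finrank K (B.orthogonal U) = 2 * N + 1 - j := by
    have h := LinearMap.BilinForm.finrank_add_finrank_orthogonal' (B := B) U
    have hz : U ⊓ LinearMap.ker B = ⊥ := by
      rw [eq_bot_iff]
      rintro x ⟨hxU, hxB⟩
      by_contra hx
      refine hQ x ?_ hx (hUQ x hxU)
      intro w
      rw [← hBa, LinearMap.mem_ker.1 hxB]
      rfl
    rw [hz, finrank_bot, hU, hdim] at h
    omega
  have hcardP : Nat.card (B.orthogonal U) = q ^ (2 * N + 1 - j) := by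
    rw [Module.natCard_eq_pow_finrank (K := K), hrank, Nat.card_eq_fintype_card]
  have hcardU : Nat.card U = q ^ j := by
    rw [Module.natCard_eq_pow_finrank (K := K), hU, Nat.card_eq_fintype_card]
  have hQr : Q r ≠ 0 := hQ r hr hr0
  have hQadd : ∀ (v : V) (a : K), Q (v + a • r) = Q v + a ^ 2 * Q r := by
    intro v a
    rw [QuadraticMap.map_add Q, QuadraticMap.map_smul, polar_smul_right, polar_comm, hr]
    simp [pow_two]
  have hsq : Function.Bijective (fun a : K => a ^ 2) := by
    have hinj : Function.Injective (fun a : K => a ^ 2) := frobenius_inj K 2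
    exact Finite.injective_iff_bijective.1 hinj
  let S := {x : V // Q x = 0 ∧ ∀ u ∈ U, polar Q u x = 0}
  have hpr : ∀ u v : V, ∀ a : K, polar Q u (v + a • r) = polar Q u v := by
    intro u v a
    rw [polar_add_right, polar_smul_right, polar_comm Q u r, hr]
    simp
  let f : S × K → B.orthogonal U := fun p => ⟨p.1.1 + p.2 • r, by
    intro u hu
    change polar Q u (p.1.1 + p.2 • r) = 0
    rw [hpr]
    exact p.1.2.2 u hu⟩
  have hf : Function.Bijective f := by
    constructor
    · rintro ⟨⟨x, hx, hx'⟩, a⟩ ⟨⟨y, hy, hy'⟩, b⟩ h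
      have h : x + a • r = y + b • r := congrArg Subtype.val h
      have h2 := congrArg Q h
      rw [hQadd, hQadd, hx, hy, zero_add, zero_add] at h2
      have hab : a = b := hsq.1 (mul_right_cancel₀ hQr h2)
      subst hab
      have := add_right_cancel h
      subst this
      rfl
    · rintro ⟨v, hv⟩
      obtain ⟨a, ha⟩ := hsq.2 (Q v / Q r)
      have ha : a ^ 2 = Q v / Q r := ha
      refine ⟨⟨⟨v + a • r, ?_, ?_⟩, a⟩, ?_⟩
      · rw [hQadd, ha, div_mul_cancel₀ _ hQr, CharTwo.add_self_eq_zero]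
      · intro u hu
        rw [hpr]
        exact hv u hu
      · apply Subtype.ext
        change v + a • r + a • r = v
        rw [add_assoc, ← add_smul, CharTwo.add_self_eq_zero, zero_smul, add_zero]
  have hS : Nat.card S = q ^ (2 * N - j) := by
    have h := Nat.card_congr (Equiv.ofBijective f hf)
    rw [Nat.card_prod, hcardP, Nat.card_eq_fintype_card (α := K), ← hq,
      show 2 * N + 1 - j = (2 * N - j) + 1 by omega, pow_succ] at h
    exact Nat.eq_of_mul_eq_mul_right hqpos h
  have e : S ≃ {x : V // x ∉ U ∧ Q x = 0 ∧ ∀ u ∈ U, polar Q u x = 0} ⊕ U :=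
    { toFun := fun x => if h : x.1 ∈ U then Sum.inr ⟨x.1, h⟩ else Sum.inl ⟨x.1, h, x.2⟩
      invFun := fun y => Sum.elim (fun x => ⟨x.1, x.2.2⟩)
        (fun x => ⟨x.1, hUQ x.1 x.2, fun u hu => hUpol u hu x.1 x.2⟩) y
      left_inv := by
        intro x
        by_cases h : x.1 ∈ U <;> simp [h]
      right_inv := by
        rintro (x | x)
        · simp [x.2.1]
        · simp }
  have hc := Nat.card_congr e
  rw [Nat.card_sum, hS, hcardU] at hc
  rw [Nat.mul_sub, mul_one, ← pow_add, show j + (2 * N - 2 * j) = 2 * N - j by omega]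
  omega

open QuadraticMap in
/-- Splitting off the first vector of a totally singular frame. -/
theorem cons_iff {K V : Type*} [Field K] [AddCommGroup V] [Module K V] {m : ℕ}
    (Q : QuadraticForm K V) (x : V) (v : Fin m → V) :
    (LinearIndependent K (Fin.cons x v : Fin (m + 1) → V) ∧
      ∀ y ∈ Submodule.span K (Set.range (Fin.cons x v : Fin (m + 1) → V)), Q y = 0) ↔
    (LinearIndependent K v ∧ ∀ y ∈ Submodule.span K (Set.range v), Q y = 0) ∧
      (x ∉ Submodule.span K (Set.range v) ∧ Q x = 0 ∧
        ∀ u ∈ Submodule.span K (Set.range v), polar Q u x = 0) := by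
  rw [linearIndependent_finCons, Fin.range_cons]
  constructor
  · rintro ⟨⟨h1, h2⟩, h3⟩
    have hsub : Submodule.span K (Set.range v) ≤ Submodule.span K (insert x (Set.range v)) :=
      Submodule.span_mono (Set.subset_insert _ _)
    have hx : x ∈ Submodule.span K (insert x (Set.range v)) :=
      Submodule.subset_span (Set.mem_insert _ _)
    refine ⟨⟨h1, fun y hy => h3 y (hsub hy)⟩, h2, h3 x hx, fun u hu => ?_⟩
    simp [polar, h3 _ hx, h3 _ (hsub hu), h3 _ (Submodule.add_mem _ (hsub hu) hx)]
  · rintro ⟨⟨h1, h2⟩, h3, h4, h5⟩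
    refine ⟨⟨h1, h3⟩, fun y hy => ?_⟩
    obtain ⟨a, z, hz, rfl⟩ := Submodule.mem_span_insert.1 hy
    rw [QuadraticMap.map_add Q, QuadraticMap.map_smul, polar_smul_left, polar_comm, h5 z hz,
      h4, h2 z hz]
    simp

/-- Over a field with `q = 2^n` elements, the number of `m`-tuples of linearly
independent vectors spanning a totally singular subspace of a nondegenerate
`(2N+1)`-dimensional quadratic space equals
`(q^{2N}-1)(q^{2N-2}-1)⋯(q^{2N-2m+2}-1) q^{m(m-1)/2}`. -/
theorem stmt_8 {K V : Type*} [Field K] [Fintype K] [AddCommGroup V] [Module K V]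
    (n N m : ℕ) (hn : 1 ≤ n) (hK : Fintype.card K = 2 ^ n) (hm : m ≤ N)
    (hdim : Module.finrank K V = 2 * N + 1)
    (Q : QuadraticForm K V)
    (hQ : ∀ v, (∀ w, QuadraticMap.polar Q v w = 0) → v ≠ 0 → Q v ≠ 0) :
    Nat.card {v : Fin m → V // LinearIndependent K v ∧
        ∀ x ∈ Submodule.span K (Set.range v), Q x = 0} =
      (∏ j ∈ Finset.range m, ((2 ^ n) ^ (2 * N - 2 * j) - 1)) *
        (2 ^ n) ^ (m * (m - 1) / 2) := by
  have hfd : FiniteDimensional K V := Module.finite_of_finrank_pos (by omega)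
  have hfin : Finite V := Module.finite_of_finite K
  have hchar : CharP K 2 := by
    have : Fact (Nat.Prime 2) := ⟨Nat.prime_two⟩
    exact charP_of_card_eq_prime_pow hK
  obtain ⟨r, hr0, hr⟩ := exists_radical N hdim (QuadraticMap.polarBilin Q) (by
    intro x
    change QuadraticMap.polar Q x x = 0
    rw [QuadraticMap.polar_self, two_nsmul, CharTwo.add_self_eq_zero])
  have hr : ∀ w, QuadraticMap.polar Q r w = 0 := hr
  induction m with
  | zero =>
    have : Unique {v : Fin 0 → V // LinearIndependent K v ∧
        ∀ x ∈ Submodule.span K (Set.range v), Q x = 0} :=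
      { default := ⟨Fin.elim0, linearIndependent_empty_type, by
          intro x hx
          rw [Set.range_eq_empty, Submodule.span_empty, Submodule.mem_bot] at hx
          rw [hx, QuadraticMap.map_zero]⟩
        uniq := fun v => Subtype.ext (Subsingleton.elim _ _) }
    simp
  | succ m ih =>
    have ih := ih (by omega)
    have e : {v : Fin (m + 1) → V // LinearIndependent K v ∧
          ∀ x ∈ Submodule.span K (Set.range v), Q x = 0} ≃
        Σ v : {v : Fin m → V // LinearIndependent K v ∧
          ∀ x ∈ Submodule.span K (Set.range v), Q x = 0},
          {x : V // x ∉ Submodule.span K (Set.range v.1) ∧ Q x = 0 ∧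
            ∀ u ∈ Submodule.span K (Set.range v.1), QuadraticMap.polar Q u x = 0} :=
      { toFun := fun s =>
          have h := (cons_iff Q (s.1 0) (Fin.tail s.1)).1 (by
            rw [Fin.cons_self_tail]; exact s.2)
          ⟨⟨Fin.tail s.1, h.1⟩, ⟨s.1 0, h.2⟩⟩
        invFun := fun p => ⟨Fin.cons p.2.1 p.1.1, (cons_iff Q p.2.1 p.1.1).2 ⟨p.1.2, p.2.2⟩⟩
        left_inv := fun s => Subtype.ext (Fin.cons_self_tail s.1)
        right_inv := fun ⟨⟨v, hv⟩, ⟨x, hx⟩⟩ => rfl }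
    have hcount := fun v : {v : Fin m → V // LinearIndependent K v ∧
          ∀ x ∈ Submodule.span K (Set.range v), Q x = 0} =>
      card_extend N m hdim (by omega) Q hQ r hr0 hr (Submodule.span K (Set.range v.1))
        (by rw [finrank_span_eq_card v.2.1, Fintype.card_fin]) v.2.2
    have hfT := Fintype.ofFinite {v : Fin m → V // LinearIndependent K v ∧
          ∀ x ∈ Submodule.span K (Set.range v), Q x = 0}
    rw [Nat.card_congr e, Nat.card_sigma, Finset.sum_congr rfl (fun v _ => hcount v),
      Finset.sum_const, Finset.card_univ, ← Nat.card_eq_fintype_card, ih, hK,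
      Finset.prod_range_succ, smul_eq_mul]
    have hexp : (m + 1) * (m + 1 - 1) / 2 = m * (m - 1) / 2 + m := by
      rw [Nat.add_sub_cancel]
      cases m with
      | zero => rfl
      | succ k =>
        rw [Nat.add_sub_cancel, show (k + 1 + 1) * (k + 1) = (k + 1) * k + (k + 1) * 2 by ring,
          Nat.add_mul_div_right _ _ two_pos]
    rw [hexp, pow_add]
    ring
end
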